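/- For every z ∈ ℂ, every partition μ of m with at most n rows, and every standard μ-tableau U, the element S_U(z) belongs to the center of U_q(gl_n); that is, all coefficients of the polynomial S_U(z) in z commute with every element of U_q(gl_n). -/

import Mathlib

open scoped Classical

noncomputable section

namespace QImm

/-- `q` is not a root of unity. -/
def NotRootOfUnity (q : ℂ) : Prop := ∀ k : ℕ, 0 < k → q ^ k ≠ 1

/-! ### The R-matrices -/

/-- The R-matrix `R = q ∑ eᵢᵢ⊗eᵢᵢ + ∑_{i≠j} eᵢᵢ⊗eⱼⱼ + (q-q⁻¹) ∑_{i<j} eᵢⱼ⊗eⱼᵢ`. -/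
def Rmat (q : ℂ) (n : ℕ) : Matrix (Fin n × Fin n) (Fin n × Fin n) ℂ := fun p r =>
  if p.1 = r.1 ∧ p.2 = r.2 then (if p.1 = p.2 then q else 1)
  else if p.2 = r.1 ∧ p.1 = r.2 ∧ p.1 < r.1 then q - q⁻¹ else 0

/-- The permutation operator `P = ∑ eᵢⱼ⊗eⱼᵢ`. -/
def Pmat (n : ℕ) : Matrix (Fin n × Fin n) (Fin n × Fin n) ℂ := fun p r =>
  if p.1 = r.2 ∧ p.2 = r.1 then 1 else 0

/-- `Ř = P R`. -/
def Rcheck (q : ℂ) (n : ℕ) : Matrix (Fin n × Fin n) (Fin n × Fin n) ℂ :=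
  Pmat n * Rmat q n

/-! ### Embeddings into tensor legs: `(End ℂⁿ)^{⊗m} ⊗ A ≅ Matrix (Fin m → Fin n) (Fin m → Fin n) A` -/

/-- An `n×n` matrix over `A` placed in the `a`-th tensor leg (0-indexed) of
`(End ℂⁿ)^{⊗m} ⊗ A`. -/
def leg1 {A : Type} [Ring A] (n m : ℕ) (X : Matrix (Fin n) (Fin n) A) (a : ℕ) :
    Matrix (Fin m → Fin n) (Fin m → Fin n) A := fun i j =>
  if h : a < m then
    if ∀ c : Fin m, (c : ℕ) ≠ a → i c = j c then X (i ⟨a, h⟩) (j ⟨a, h⟩) else 0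
  else 0

/-- A scalar element of `End ℂⁿ ⊗ End ℂⁿ` placed in the `a`-th and `b`-th tensor legs
(0-indexed) of `(End ℂⁿ)^{⊗m} ⊗ A`. -/
def leg2 (A : Type) [Ring A] [Algebra ℂ A] (n m : ℕ)
    (C : Matrix (Fin n × Fin n) (Fin n × Fin n) ℂ) (a b : ℕ) :
    Matrix (Fin m → Fin n) (Fin m → Fin n) A := fun i j =>
  if h : a < m ∧ b < m then
    if ∀ c : Fin m, (c : ℕ) ≠ a → (c : ℕ) ≠ b → i c = j c then
      algebraMap ℂ A (C (i ⟨a, h.1⟩, i ⟨b, h.2⟩) (j ⟨a, h.1⟩, j ⟨b, h.2⟩))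
    else 0
  else 0

/-- `Ř_{k+1}` (paper numbering), acting in the tensor legs `k`, `k+1` (0-indexed). -/
def RcLeg (A : Type) [Ring A] [Algebra ℂ A] (q : ℂ) (n m : ℕ) (k : ℕ) :
    Matrix (Fin m → Fin n) (Fin m → Fin n) A :=
  leg2 A n m (Rcheck q n) k (k + 1)

/-- `Ř⁻¹_{k+1}` (paper numbering), acting in the tensor legs `k`, `k+1` (0-indexed). -/
def RcLegInv (A : Type) [Ring A] [Algebra ℂ A] (q : ℂ) (n m : ℕ) (k : ℕ) :
    Matrix (Fin m → Fin n) (Fin m → Fin n) A :=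
  leg2 A n m (Rcheck q n)⁻¹ k (k + 1)

/-- `legBar q n m X k` is `X_{\overline{k+1}}` (paper numbering), so `legBar q n m X 0 = X₁`
and `X_{\overline{k+1}} = Ř_k X_{\overline{k}} Ř_k⁻¹`. -/
def legBar {A : Type} [Ring A] [Algebra ℂ A] (q : ℂ) (n m : ℕ)
    (X : Matrix (Fin n) (Fin n) A) : ℕ → Matrix (Fin m → Fin n) (Fin m → Fin n) A
  | 0 => leg1 n m X 0
  | k + 1 => RcLeg A q n m k * legBar q n m X k * RcLegInv A q n m k

/-! ### q-traces -/

/-- The q-trace over all `m` tensor legs: `tr_{q(1,…,m)} Y = tr D₁⋯D_m Y` with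
`D = diag(1, q⁻², …, q^{-2n+2})`. -/
def qTr {A : Type} [Ring A] [Algebra ℂ A] (q : ℂ) (n m : ℕ)
    (Y : Matrix (Fin m → Fin n) (Fin m → Fin n) A) : A :=
  ∑ i : Fin m → Fin n,
    algebraMap ℂ A (∏ a : Fin m, q ^ (-2 * ((i a : ℕ) : ℤ))) * Y i i

/-- The q-trace of a single `n×n` matrix: `tr_q X = tr D X`. -/
def qTr1 {A : Type} [Ring A] [Algebra ℂ A] (q : ℂ) (n : ℕ)
    (X : Matrix (Fin n) (Fin n) A) : A :=
  ∑ j : Fin n, algebraMap ℂ A (q ^ (-2 * ((j : ℕ) : ℤ))) * X j j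

/-! ### The Hecke algebra -/

/-- The defining relations of the Hecke algebra `H_m` on generators `T_1, …, T_{m-1}`
(the generator `i : Fin (m-1)` is `T_{i+1}` in 1-indexed paper notation). -/
inductive HeckeRel (q : ℂ) (m : ℕ) :
    FreeAlgebra ℂ (Fin (m - 1)) → FreeAlgebra ℂ (Fin (m - 1)) → Prop
  | quad (i : Fin (m - 1)) :
      HeckeRel q m
        ((FreeAlgebra.ι ℂ i - algebraMap ℂ (FreeAlgebra ℂ (Fin (m - 1))) q) *
          (FreeAlgebra.ι ℂ i + algebraMap ℂ (FreeAlgebra ℂ (Fin (m - 1))) q⁻¹)) 0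
  | braid (i j : Fin (m - 1)) (h : (j : ℕ) = (i : ℕ) + 1) :
      HeckeRel q m (FreeAlgebra.ι ℂ i * FreeAlgebra.ι ℂ j * FreeAlgebra.ι ℂ i)
        (FreeAlgebra.ι ℂ j * FreeAlgebra.ι ℂ i * FreeAlgebra.ι ℂ j)
  | commute (i j : Fin (m - 1)) (h : (i : ℕ) + 1 < (j : ℕ)) :
      HeckeRel q m (FreeAlgebra.ι ℂ i * FreeAlgebra.ι ℂ j)
        (FreeAlgebra.ι ℂ j * FreeAlgebra.ι ℂ i)

/-- The Hecke algebra `H_m`. -/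
abbrev Hecke (q : ℂ) (m : ℕ) := RingQuot (HeckeRel q m)

/-- The generator `T_{i+1}` (paper 1-indexed) of `H_m`. -/
def Tgen (q : ℂ) (m : ℕ) (i : Fin (m - 1)) : Hecke q m :=
  RingQuot.mkAlgHom ℂ (HeckeRel q m) (FreeAlgebra.ι ℂ i)

/-- `T_{k+1}` (paper 1-indexed), i.e. the 0-indexed `k`-th generator; junk value `1`
out of range. -/
def Tn (q : ℂ) (m : ℕ) (k : ℕ) : Hecke q m :=
  if h : k < m - 1 then Tgen q m ⟨k, h⟩ else 1

/-- The paper's 1-indexed generator `T_a`, `a = 1, …, m-1`. -/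
def Tp (q : ℂ) (m : ℕ) (a : ℕ) : Hecke q m := Tn q m (a - 1)

/-- The Jucys–Murphy elements, 1-indexed: `y_1 = 1`, `y_{k+1} = T_k ⋯ T_2 T_1² T_2 ⋯ T_k`
(the value at `0` is a junk value `1`). -/
def yJM (q : ℂ) (m : ℕ) : ℕ → Hecke q m
  | 0 => 1
  | 1 => 1
  | k + 2 => Tp q m (k + 1) * yJM q m (k + 1) * Tp q m (k + 1)

/-- The element `T_{(i,j)} = T_i T_{i+1} ⋯ T_{j-2} T_{j-1} T_{j-2} ⋯ T_{i+1} T_i` of `H_m`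
associated with the transposition `(i,j)`, `1 ≤ i < j` (paper 1-indexed). -/
def Ttrans (q : ℂ) (m : ℕ) (i j : ℕ) : Hecke q m :=
  ((List.range' i (j - i)).map (Tp q m)).prod *
    (((List.range' i (j - 1 - i)).map (Tp q m)).reverse).prod

/-- The condition that `φ : H_m → End((ℂⁿ)^{⊗m})` is the algebra homomorphism sending
`T_k ↦ Ř_k`. -/
def IsHeckeRep (q : ℂ) (n m : ℕ)
    (φ : Hecke q m →ₐ[ℂ] Matrix (Fin m → Fin n) (Fin m → Fin n) ℂ) : Prop :=
  ∀ k : ℕ, k < m - 1 → φ (Tn q m k) = RcLeg ℂ q n m k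

/-! ### Young diagrams and standard tableaux -/

/-- The content `c(α) = j - i` of a box `α = (i, j)` (row `i`, column `j`, 0-indexed). -/
def ctn (α : ℕ × ℕ) : ℤ := (α.2 : ℤ) - (α.1 : ℤ)

/-- A standard tableau of shape `μ` with `m` boxes, recorded via the position `pos k` of
each entry `k ∈ {1, …, m}`; entries strictly increase along rows and down columns. -/
structure StdTab (μ : YoungDiagram) (m : ℕ) where
  pos : ℕ → ℕ × ℕ
  bij : Set.BijOn pos (Set.Icc 1 m) (μ.cells : Set (ℕ × ℕ))
  row_lt : ∀ k ∈ Set.Icc 1 m, ∀ l ∈ Set.Icc 1 m,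
    (pos k).1 = (pos l).1 → (pos k).2 < (pos l).2 → k < l
  col_lt : ∀ k ∈ Set.Icc 1 m, ∀ l ∈ Set.Icc 1 m,
    (pos k).2 = (pos l).2 → (pos k).1 < (pos l).1 → k < l

/-- `c_k(U)`, the content of the box of `U` occupied by `k`. -/
def ctnAt {μ : YoungDiagram} {m : ℕ} (U : StdTab μ m) (k : ℕ) : ℤ := ctn (U.pos k)

/-- The condition singling out the primitive idempotent `e_U` of `H_m` associated with a
standard tableau `U`: a nonzero idempotent with `y_k e_U = e_U y_k = q^{2c_k(U)} e_U`. -/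
def IsJMIdem (q : ℂ) (m : ℕ) {μ : YoungDiagram} (U : StdTab μ m) (e : Hecke q m) : Prop :=
  e ≠ 0 ∧ e * e = e ∧ ∀ k : ℕ, 1 ≤ k → k ≤ m →
    yJM q m k * e = (q ^ (2 * ctnAt U k) : ℂ) • e ∧
    e * yJM q m k = (q ^ (2 * ctnAt U k) : ℂ) • e

/-! ### The quantized enveloping algebra `U_q(gl_n)` -/

/-- Generators: `inl (i,j) ↦ l⁺_{ij}`, `inr (i,j) ↦ l⁻_{ij}`. -/
abbrev UqGen (n : ℕ) := (Fin n × Fin n) ⊕ (Fin n × Fin n)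

def lpF (n : ℕ) (i j : Fin n) : FreeAlgebra ℂ (UqGen n) := FreeAlgebra.ι ℂ (Sum.inl (i, j))
def lmF (n : ℕ) (i j : Fin n) : FreeAlgebra ℂ (UqGen n) := FreeAlgebra.ι ℂ (Sum.inr (i, j))

/-- A matrix `X` over `F` placed in the first of two matrix legs of
`End ℂⁿ ⊗ End ℂⁿ ⊗ F`. -/
def M1 {F : Type} [Ring F] {n : ℕ} (X : Fin n → Fin n → F) :
    Matrix (Fin n × Fin n) (Fin n × Fin n) F := fun p r => if p.2 = r.2 then X p.1 r.1 else 0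

/-- A matrix `X` over `F` placed in the second of two matrix legs of
`End ℂⁿ ⊗ End ℂⁿ ⊗ F`. -/
def M2 {F : Type} [Ring F] {n : ℕ} (X : Fin n → Fin n → F) :
    Matrix (Fin n × Fin n) (Fin n × Fin n) F := fun p r => if p.1 = r.1 then X p.2 r.2 else 0

/-- The R-matrix, viewed over the free algebra on the generators of `U_q(gl_n)`. -/
def RmatU (q : ℂ) (n : ℕ) : Matrix (Fin n × Fin n) (Fin n × Fin n) (FreeAlgebra ℂ (UqGen n)) :=
  (Rmat q n).map (algebraMap ℂ (FreeAlgebra ℂ (UqGen n)))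

/-- The defining relations of `U_q(gl_n)`. -/
inductive UqRel (q : ℂ) (n : ℕ) :
    FreeAlgebra ℂ (UqGen n) → FreeAlgebra ℂ (UqGen n) → Prop
  | upperZero (i j : Fin n) (h : j < i) : UqRel q n (lpF n i j) 0
  | lowerZero (i j : Fin n) (h : i < j) : UqRel q n (lmF n i j) 0
  | diagPM (i : Fin n) : UqRel q n (lpF n i i * lmF n i i) 1
  | diagMP (i : Fin n) : UqRel q n (lmF n i i * lpF n i i) 1
  | rllPP (x y : Fin n × Fin n) :
      UqRel q n ((RmatU q n * M1 (lpF n) * M2 (lpF n)) x y)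
        ((M2 (lpF n) * M1 (lpF n) * RmatU q n) x y)
  | rllMM (x y : Fin n × Fin n) :
      UqRel q n ((RmatU q n * M1 (lmF n) * M2 (lmF n)) x y)
        ((M2 (lmF n) * M1 (lmF n) * RmatU q n) x y)
  | rllPM (x y : Fin n × Fin n) :
      UqRel q n ((RmatU q n * M1 (lpF n) * M2 (lmF n)) x y)
        ((M2 (lmF n) * M1 (lpF n) * RmatU q n) x y)

/-- The quantized enveloping algebra `U_q(gl_n)`. -/
abbrev Uq (q : ℂ) (n : ℕ) := RingQuot (UqRel q n)

def lp (q : ℂ) (n : ℕ) (i j : Fin n) : Uq q n := RingQuot.mkAlgHom ℂ (UqRel q n) (lpF n i j)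
def lm (q : ℂ) (n : ℕ) (i j : Fin n) : Uq q n := RingQuot.mkAlgHom ℂ (UqRel q n) (lmF n i j)

/-- The matrix `L⁺`. -/
def Lp (q : ℂ) (n : ℕ) : Matrix (Fin n) (Fin n) (Uq q n) := Matrix.of fun i j => lp q n i j
/-- The matrix `L⁻`. -/
def Lm (q : ℂ) (n : ℕ) : Matrix (Fin n) (Fin n) (Uq q n) := Matrix.of fun i j => lm q n i j

/-- `L = L⁺ (L⁻)⁻¹`, where `K` is the (two-sided) inverse of `L⁻`. -/
def Lmat (q : ℂ) (n : ℕ) (K : Matrix (Fin n) (Fin n) (Uq q n)) :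
    Matrix (Fin n) (Fin n) (Uq q n) := Lp q n * K

/-! ### The braided Weyl algebra -/

/-- Generators: `inl (i,j) ↦ m_{ij}`, `inr (i,j) ↦ ∂_{ij}`. -/
abbrev WGen (n : ℕ) := (Fin n × Fin n) ⊕ (Fin n × Fin n)

def mgF (n : ℕ) (i j : Fin n) : FreeAlgebra ℂ (WGen n) := FreeAlgebra.ι ℂ (Sum.inl (i, j))
def dgF (n : ℕ) (i j : Fin n) : FreeAlgebra ℂ (WGen n) := FreeAlgebra.ι ℂ (Sum.inr (i, j))

def RcW (q : ℂ) (n : ℕ) : Matrix (Fin n × Fin n) (Fin n × Fin n) (FreeAlgebra ℂ (WGen n)) :=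
  (Rcheck q n).map (algebraMap ℂ (FreeAlgebra ℂ (WGen n)))

def RcWInv (q : ℂ) (n : ℕ) : Matrix (Fin n × Fin n) (Fin n × Fin n) (FreeAlgebra ℂ (WGen n)) :=
  ((Rcheck q n)⁻¹).map (algebraMap ℂ (FreeAlgebra ℂ (WGen n)))

/-- The defining relations of the braided Weyl algebra `W_n`. -/
inductive WRel (q : ℂ) (n : ℕ) :
    FreeAlgebra ℂ (WGen n) → FreeAlgebra ℂ (WGen n) → Prop
  | mm (x y : Fin n × Fin n) :
      WRel q n ((RcW q n * M1 (mgF n) * RcW q n * M1 (mgF n)) x y)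
        ((M1 (mgF n) * RcW q n * M1 (mgF n) * RcW q n) x y)
  | dd (x y : Fin n × Fin n) :
      WRel q n ((RcWInv q n * M1 (dgF n) * RcWInv q n * M1 (dgF n)) x y)
        ((M1 (dgF n) * RcWInv q n * M1 (dgF n) * RcWInv q n) x y)
  | dm (x y : Fin n × Fin n) :
      WRel q n ((M1 (dgF n) * RcW q n * M1 (mgF n)) x y)
        ((RcW q n * M1 (mgF n) * RcWInv q n * M1 (dgF n) * RcWInv q n + 1) x y)

/-- The braided Weyl algebra `W_n`. -/
abbrev Weyl (q : ℂ) (n : ℕ) := RingQuot (WRel q n)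

def mW (q : ℂ) (n : ℕ) (i j : Fin n) : Weyl q n := RingQuot.mkAlgHom ℂ (WRel q n) (mgF n i j)
def dW (q : ℂ) (n : ℕ) (i j : Fin n) : Weyl q n := RingQuot.mkAlgHom ℂ (WRel q n) (dgF n i j)

/-- The matrix `M = [m_{ij}]` over `W_n`. -/
def Mmat (q : ℂ) (n : ℕ) : Matrix (Fin n) (Fin n) (Weyl q n) := Matrix.of fun i j => mW q n i j
/-- The matrix `𝒟 = [∂_{ij}]` over `W_n`. -/
def Dmat (q : ℂ) (n : ℕ) : Matrix (Fin n) (Fin n) (Weyl q n) := Matrix.of fun i j => dW q n i j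

/-- The image `L = M𝒟 - (q - q⁻¹)⁻¹·1` of `L` in the braided Weyl algebra. -/
def LW (q : ℂ) (n : ℕ) : Matrix (Fin n) (Fin n) (Weyl q n) :=
  Mmat q n * Dmat q n - ((q - q⁻¹)⁻¹ : ℂ) • 1

/-! ### The q-immanant polynomials -/

/-- The matrix `(L_{1̄} + z q^{-2c₁(U)}) ⋯ (L_{m̄} + z q^{-2c_m(U)}) E_U`, where `E` is the
image `E_U` of the primitive idempotent `e_U`. -/
def prodU {A : Type} [Ring A] [Algebra ℂ A] (q : ℂ) (n m : ℕ) {μ : YoungDiagram}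
    (U : StdTab μ m) (E : Matrix (Fin m → Fin n) (Fin m → Fin n) ℂ)
    (X : Matrix (Fin n) (Fin n) A) (z : ℂ) :
    Matrix (Fin m → Fin n) (Fin m → Fin n) A :=
  (((List.range m).map fun k =>
      legBar q n m X k + ((z * q ^ (-2 * ctnAt U (k + 1))) : ℂ) • 1)).prod *
    E.map (algebraMap ℂ A)

/-- The q-immanant polynomial
`S_U(z) = tr_{q(1,…,m)} (L_{1̄} + z q^{-2c₁(U)}) ⋯ (L_{m̄} + z q^{-2c_m(U)}) E_U`. -/
def SUpoly {A : Type} [Ring A] [Algebra ℂ A] (q : ℂ) (n m : ℕ) {μ : YoungDiagram}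
    (U : StdTab μ m) (E : Matrix (Fin m → Fin n) (Fin m → Fin n) ℂ)
    (X : Matrix (Fin n) (Fin n) A) (z : ℂ) : A :=
  qTr q n m (prodU q n m U E X z)

/-- The coefficient `a_μ = ∏_{α ∈ μ} q^{-2c(α)}`. -/
def aCoeff (q : ℂ) (μ : YoungDiagram) : ℂ := ∏ α ∈ μ.cells, q ^ (-2 * ctn α)

/-- `tr_{q(1,…,m)} L_{1̄} ⋯ L_{m̄} E_{(1^m)}`, where `Em` is the image of the primitive
idempotent associated with the column diagram `(1^m)`. -/
def colElem (q : ℂ) (n k : ℕ) (K : Matrix (Fin n) (Fin n) (Uq q n))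
    (φk : Hecke q k →ₐ[ℂ] Matrix (Fin k → Fin n) (Fin k → Fin n) ℂ)
    (ek : Hecke q k) : Uq q n :=
  qTr q n k (((List.range k).map fun j => legBar q n k (Lmat q n K) j).prod *
    (φk ek).map (algebraMap ℂ (Uq q n)))

/-- The semistandardness condition on a filling of the boxes of `μ` with entries in
`{1, …, n}` (encoded as `Fin n`): weakly increasing along rows, strictly increasing
down columns. -/
def SSYTCond {n : ℕ} (μ : YoungDiagram) (f : {x // x ∈ μ.cells} → Fin n) : Prop :=
  (∀ a b : {x // x ∈ μ.cells}, (a : ℕ × ℕ).1 = (b : ℕ × ℕ).1 →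
    (a : ℕ × ℕ).2 ≤ (b : ℕ × ℕ).2 → f a ≤ f b) ∧
  (∀ a b : {x // x ∈ μ.cells}, (a : ℕ × ℕ).2 = (b : ℕ × ℕ).2 →
    (a : ℕ × ℕ).1 < (b : ℕ × ℕ).1 → f a < f b)

/-- The factorial Schur polynomial `s_μ(x₁,…,x_n | a)` evaluated at `x_i = q^{2ℓ_i}`,
`ℓ_i = λ_i - i + 1` (1-indexed), with parameter sequence `a_j = z q^{1-2j}`. -/
def factSchur {n : ℕ} (q z : ℂ) (lam : Fin n → ℤ) (μ : YoungDiagram) : ℂ :=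
  ∑ f : {x // x ∈ μ.cells} → Fin n,
    if SSYTCond μ f then
      ∏ α : {x // x ∈ μ.cells},
        (q ^ (2 * (lam (f α) - ((f α : ℕ) : ℤ))) +
          z * q ^ (1 - 2 * (((f α : ℕ) : ℤ) + 1 + ctn (α : ℕ × ℕ))))
    else 0

section Legs

variable {A : Type} [Ring A] {n m : ℕ}

/-- Operators on `(ℂⁿ)^{⊗m}` with coefficients in `A`. -/
abbrev TMat (A : Type) (n m : ℕ) := Matrix (Fin m → Fin n) (Fin m → Fin n) A

lemma leg1_apply (X : Matrix (Fin n) (Fin n) A) (a : Fin m) (i j : Fin m → Fin n) :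
    leg1 n m X a i j = if ∀ c, c ≠ a → i c = j c then X (i a) (j a) else 0 := by
  simp [leg1, Fin.ext_iff]

lemma sum_agree_off (a : Fin m) (i : Fin m → Fin n) (f : (Fin m → Fin n) → A) :
    (∑ k, if ∀ c, c ≠ a → i c = k c then f k else 0) =
      ∑ x, f (Function.update i a x) := by
  rw [← Finset.sum_filter]
  refine Finset.sum_bij' (fun k _ => k a) (fun x _ => Function.update i a x) ?_ ?_ ?_ ?_ ?_
  · simp
  · intro x _
    simp +contextual [Function.update_of_ne]
  · intro k hk
    simp only [Finset.mem_filter, Finset.mem_univ, true_and] at hk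
    funext c
    by_cases hc : c = a
    · subst hc; simp
    · simp [Function.update_of_ne hc, hk c hc]
  · simp
  · intro k hk
    simp only [Finset.mem_filter, Finset.mem_univ, true_and] at hk
    congr 1
    funext c
    by_cases hc : c = a
    · subst hc; simp
    · simp [Function.update_of_ne hc, hk c hc]

lemma leg1_mul_apply (X : Matrix (Fin n) (Fin n) A) (a : Fin m) (Z : TMat A n m)
    (i j : Fin m → Fin n) :
    (leg1 n m X a * Z) i j = ∑ x, X (i a) x * Z (Function.update i a x) j := by
  simp only [Matrix.mul_apply, leg1_apply, ite_mul, zero_mul]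
  rw [sum_agree_off a i fun k => X (i a) (k a) * Z k j]
  simp

/-- Placing a matrix in the tensor leg `a` is a ring homomorphism. -/
def leg1Hom (A : Type) [Ring A] (n : ℕ) {m : ℕ} (a : Fin m) :
    Matrix (Fin n) (Fin n) A →+* TMat A n m where
  toFun X := leg1 n m X a
  map_one' := by
    ext i j
    rw [leg1_apply, Matrix.one_apply, Matrix.one_apply]
    by_cases h : i = j
    · simp [h]
    · rw [if_neg h]
      split_ifs with h1 h2
      · refine absurd (funext fun c => ?_) h
        by_cases hc : c = a
        · rw [hc, h2]
        · exact h1 c hc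
      · rfl
      · rfl
  map_mul' X Y := by
    ext i j
    rw [leg1_mul_apply, leg1_apply]
    simp only [leg1_apply, Matrix.mul_apply, Function.update_self]
    split_ifs with h
    · refine Finset.sum_congr rfl fun x _ => ?_
      rw [if_pos fun c hc => by rw [Function.update_of_ne hc, h c hc]]
    · refine (Finset.sum_eq_zero fun x _ => ?_).symm
      rw [if_neg, mul_zero]
      exact fun h' => h fun c hc => by simpa [Function.update_of_ne hc] using h' c hc
  map_zero' := by ext i j; simp [leg1_apply]
  map_add' X Y := by
    ext i j
    simp only [leg1_apply, Matrix.add_apply]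
    split_ifs <;> simp

lemma leg1Hom_apply (X : Matrix (Fin n) (Fin n) A) (a : Fin m) :
    leg1Hom A n a X = leg1 n m X a := rfl

lemma leg1_mul_leg1_apply {a b : Fin m} (hab : a ≠ b) (X Y : Matrix (Fin n) (Fin n) A)
    (i j : Fin m → Fin n) :
    (leg1 n m X a * leg1 n m Y b) i j =
      if ∀ c, c ≠ a → c ≠ b → i c = j c then X (i a) (j a) * Y (i b) (j b) else 0 := by
  simp only [leg1_mul_apply, leg1_apply]
  rw [Finset.sum_eq_single (j a)]
  · rw [Function.update_of_ne hab.symm]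
    by_cases h : ∀ c, c ≠ a → c ≠ b → i c = j c
    · rw [if_pos h, if_pos]
      intro c hc
      by_cases hca : c = a
      · subst hca; simp
      · rw [Function.update_of_ne hca, h c hca hc]
    · rw [if_neg h, if_neg, mul_zero]
      exact fun h' => h fun c hca hcb => by simpa [Function.update_of_ne hca] using h' c hcb
  · intro x _ hx
    rw [if_neg, mul_zero]
    exact fun h' => hx (by simpa using h' a hab)
  · simp

lemma leg1_commute_leg1 {a b : Fin m} (hab : a ≠ b) {X Y : Matrix (Fin n) (Fin n) A}
    (h : ∀ i j k l, Commute (X i j) (Y k l)) :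
    Commute (leg1 n m X a) (leg1 n m Y b) := by
  ext i j
  rw [leg1_mul_leg1_apply hab, leg1_mul_leg1_apply hab.symm, (h _ _ _ _).eq]
  refine if_congr (forall_congr' fun c => ?_) rfl rfl
  tauto

lemma diagonal_commute_leg1 (d : (Fin m → Fin n) → A) (hd : ∀ i x, Commute (d i) x) (a : Fin m)
    (h : ∀ i x, d (Function.update i a x) = d i) (X : Matrix (Fin n) (Fin n) A) :
    Commute (Matrix.diagonal d) (leg1 n m X a) := by
  ext i j
  rw [Matrix.diagonal_mul, Matrix.mul_diagonal, leg1_apply]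
  split_ifs with hij
  · have : j = Function.update i a (j a) := by
      funext c
      by_cases hc : c = a
      · subst hc; simp
      · rw [Function.update_of_ne hc, hij c hc]
    rw [this, h, Function.update_self, (hd i _).eq]
  · simp

lemma sum_agree_off_pair {a b : Fin m} (hab : a ≠ b) (i : Fin m → Fin n)
    (f : (Fin m → Fin n) → A) :
    (∑ k, if ∀ c, c ≠ a → c ≠ b → i c = k c then f k else 0) =
      ∑ x : Fin n × Fin n, f (Function.update (Function.update i a x.1) b x.2) := by
  have key (k : Fin m → Fin n) (hk : ∀ c, c ≠ a → c ≠ b → i c = k c) :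
      Function.update (Function.update i a (k a)) b (k b) = k := by
    funext c
    by_cases hc : c = b
    · subst hc; simp
    · by_cases hc' : c = a
      · subst hc'; simp [Function.update_of_ne hc]
      · simp [Function.update_of_ne hc, Function.update_of_ne hc', hk c hc' hc]
  rw [← Finset.sum_filter]
  refine Finset.sum_bij' (fun k _ => (k a, k b))
    (fun x _ => Function.update (Function.update i a x.1) b x.2) ?_ ?_ ?_ ?_ ?_
  · simp
  · intro x _
    simp +contextual [Function.update_of_ne]
  · intro k hk
    simp only [Finset.mem_filter, Finset.mem_univ, true_and] at hk
    exact key k hk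
  · simp [Function.update_of_ne hab]
  · intro k hk
    simp only [Finset.mem_filter, Finset.mem_univ, true_and] at hk
    rw [key k hk]

variable [Algebra ℂ A]

lemma leg2_apply (C : Matrix (Fin n × Fin n) (Fin n × Fin n) ℂ) (a b : Fin m)
    (i j : Fin m → Fin n) :
    leg2 A n m C a b i j = if ∀ c, c ≠ a → c ≠ b → i c = j c then
      algebraMap ℂ A (C (i a, i b) (j a, j b)) else 0 := by
  simp [leg2, Fin.ext_iff]

lemma leg2_mul_apply (C : Matrix (Fin n × Fin n) (Fin n × Fin n) ℂ) {a b : Fin m} (hab : a ≠ b)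
    (Z : TMat A n m) (i j : Fin m → Fin n) :
    (leg2 A n m C a b * Z) i j = ∑ x : Fin n × Fin n, algebraMap ℂ A (C (i a, i b) x) *
      Z (Function.update (Function.update i a x.1) b x.2) j := by
  simp only [Matrix.mul_apply, leg2_apply, ite_mul, zero_mul]
  rw [sum_agree_off_pair hab i fun k => algebraMap ℂ A (C (i a, i b) (k a, k b)) * Z k j]
  simp [Function.update_of_ne hab]

lemma leg2_mul_leg2 (C C' : Matrix (Fin n × Fin n) (Fin n × Fin n) ℂ) {a b : Fin m}
    (hab : a ≠ b) :
    leg2 A n m C a b * leg2 A n m C' a b = leg2 A n m (C * C') a b := by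
  ext i j
  simp only [leg2_mul_apply _ hab, leg2_apply, Matrix.mul_apply, Function.update_self,
    Function.update_of_ne hab, map_sum, map_mul]
  split_ifs with h
  · refine Finset.sum_congr rfl fun x _ => ?_
    rw [if_pos fun c hca hcb => by
      rw [Function.update_of_ne hcb, Function.update_of_ne hca, h c hca hcb]]
  · refine Finset.sum_eq_zero fun x _ => ?_
    rw [if_neg, mul_zero]
    exact fun h' => h fun c hca hcb => by
      simpa [Function.update_of_ne hca, Function.update_of_ne hcb] using h' c hca hcb

lemma leg2_commute_leg1 (C : Matrix (Fin n × Fin n) (Fin n × Fin n) ℂ) {a b c : Fin m}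
    (hab : a ≠ b) (hca : c ≠ a) (hcb : c ≠ b) (X : Matrix (Fin n) (Fin n) A) :
    Commute (leg2 A n m C a b) (leg1 n m X c) := by
  ext i j
  rw [leg2_mul_apply _ hab, leg1_mul_apply, Finset.sum_eq_single (j a, j b),
    Finset.sum_eq_single (j c)]
  · simp only [leg1_apply, leg2_apply, Function.update_of_ne hca, Function.update_of_ne hcb,
      Function.update_of_ne hca.symm, Function.update_of_ne hcb.symm]
    by_cases h : ∀ d, d ≠ a → d ≠ b → d ≠ c → i d = j d
    · rw [if_pos, if_pos, Algebra.commutes]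
      · intro d hda hdb
        by_cases hdc : d = c
        · subst hdc; simp
        · rw [Function.update_of_ne hdc, h d hda hdb hdc]
      · intro d hdc
        by_cases hdb : d = b
        · subst hdb; simp
        · rw [Function.update_of_ne hdb]
          by_cases hda : d = a
          · subst hda; simp
          · rw [Function.update_of_ne hda, h d hda hdb hdc]
    · rw [if_neg, if_neg, mul_zero, mul_zero]
      · exact fun h' => h fun d hda hdb hdc => by
          simpa [Function.update_of_ne hdc] using h' d hda hdb
      · exact fun h' => h fun d hda hdb hdc => by
          simpa [Function.update_of_ne hda, Function.update_of_ne hdb] using h' d hdc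
  · intro x _ hx
    rw [leg2_apply, if_neg, mul_zero]
    exact fun h' => hx (by simpa using h' c hca hcb)
  · simp
  · intro x _ hx
    rw [leg1_apply, if_neg, mul_zero]
    intro h'
    have h1 := h' a hca.symm
    have h2 := h' b hcb.symm
    rw [Function.update_of_ne hab, Function.update_self] at h1
    rw [Function.update_self] at h2
    exact hx (Prod.ext h1 h2)
  · simp

end Legs

section RMatrix

variable {n : ℕ}

/-- The matrix `t ∑ eᵢᵢ⊗eᵢᵢ + ∑_{i≠j} eᵢᵢ⊗eⱼⱼ + (t-t⁻¹) ∑_{r i j} eᵢⱼ⊗eⱼᵢ`. -/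
def rGen (t : ℂ) (r : Fin n → Fin n → Prop) : Matrix (Fin n × Fin n) (Fin n × Fin n) ℂ :=
  fun x y => (if x.1 = x.2 then t else 1) * (if x.1 = y.1 ∧ x.2 = y.2 then 1 else 0) +
    (if r x.1 x.2 then t - t⁻¹ else 0) * (if x.2 = y.1 ∧ x.1 = y.2 then 1 else 0)

lemma Rmat_eq_rGen (q : ℂ) : Rmat q n = rGen q (· < ·) := by
  ext ⟨a, b⟩ ⟨c, d⟩
  simp only [Rmat, rGen]
  by_cases h1 : a = c <;> by_cases h2 : b = d <;> by_cases h3 : b = c <;> by_cases h4 : a = d <;>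
    simp_all

lemma sum_rGen_mul (t : ℂ) (r : Fin n → Fin n → Prop) (a b : Fin n) (f : Fin n × Fin n → ℂ) :
    ∑ x, rGen t r (a, b) x * f x =
      (if a = b then t else 1) * f (a, b) + (if r a b then t - t⁻¹ else 0) * f (b, a) := by
  have h (x : Fin n × Fin n) : rGen t r (a, b) x * f x =
      (if (a, b) = x then (if a = b then t else 1) * f x else 0) +
        (if (b, a) = x then (if r a b then t - t⁻¹ else 0) * f x else 0) := by
    simp only [rGen, Prod.ext_iff]
    split_ifs <;> ring
  simp [h, Finset.sum_add_distrib]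

lemma rGen_mul_inv {t : ℂ} (ht : t ≠ 0) (r : Fin n → Fin n → Prop)
    (hr : ∀ a b, r a b → ¬ r b a) : rGen t r * rGen t⁻¹ r = 1 := by
  have hirr (a : Fin n) : ¬ r a a := fun h => hr a a h h
  ext ⟨a, b⟩ ⟨c, d⟩
  rw [Matrix.mul_apply, sum_rGen_mul, Matrix.one_apply]
  simp only [rGen, Prod.mk.injEq, inv_inv]
  by_cases hab : a = b
  · subst hab
    simp [hirr, ht]
  · have hba : b ≠ a := Ne.symm hab
    by_cases h : r a b
    · simp only [hab, hba, h, hr a b h, if_true, if_false]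
      ring
    · simp only [hab, hba, h, if_false]
      ring

lemma Rcheck_apply (q : ℂ) (a b : Fin n) (y : Fin n × Fin n) :
    Rcheck q n (a, b) y = Rmat q n (b, a) y := by
  rw [Rcheck, Matrix.mul_apply, Finset.sum_eq_single (b, a)]
  · simp [Pmat]
  · rintro ⟨c, d⟩ _ h
    simp only [Pmat]
    rw [if_neg, zero_mul]
    rintro ⟨rfl, rfl⟩
    exact h rfl
  · simp

lemma rGen_lt_symm (t : ℂ) (a b c d : Fin n) :
    rGen t (· < ·) (a, b) (c, d) = rGen t (· < ·) (d, c) (b, a) := by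
  simp only [rGen]
  by_cases h1 : a = c <;> by_cases h2 : b = d <;> by_cases h3 : b = c <;> by_cases h4 : a = d <;>
    simp_all [eq_comm]

/-- The `(i, k)` block of `S_{02} S_{01}`, as an operator on the tensor legs `1` and `2`. -/
def blockPair (S : Matrix (Fin n × Fin n) (Fin n × Fin n) ℂ) (i k : Fin n) :
    Matrix (Fin n × Fin n) (Fin n × Fin n) ℂ :=
  fun x y => ∑ j, S (i, x.2) (j, y.2) * S (j, x.1) (k, y.1)

/-- The action of `rGen t r` on a pair of arguments. -/
def rAct (t : ℂ) (r : Fin n → Fin n → Prop) (f : Fin n → Fin n → ℂ) (a b : Fin n) : ℂ :=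
  (if a = b then t else 1) * f a b + (if r a b then t - t⁻¹ else 0) * f b a

lemma blockPair_apply (t : ℂ) (r : Fin n → Fin n → Prop) (i k b c : Fin n) (y : Fin n × Fin n) :
    blockPair (rGen t r) i k (b, c) y =
      rAct t r (fun i' c' => rAct t r (fun i'' b' =>
        if i'' = k ∧ b' = y.1 ∧ c' = y.2 then 1 else 0) i' b) i c := by
  have inner (i' c' : Fin n) : rAct t r (fun i'' b' =>
      if i'' = k ∧ b' = y.1 ∧ c' = y.2 then 1 else 0) i' b =
      if c' = y.2 then rGen t r (i', b) (k, y.1) else 0 := by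
    by_cases h : c' = y.2 <;> simp [rAct, rGen, h]
  have h := sum_rGen_mul t r i c fun x => if x.2 = y.2 then rGen t r (x.1, b) (k, y.1) else 0
  rw [Fintype.sum_prod_type] at h
  simp only [mul_ite, mul_zero, Finset.sum_ite_eq', Finset.mem_univ, if_true] at h
  simp only [blockPair, inner]
  rw [h]
  simp only [rAct, mul_ite, mul_zero]

lemma Rcheck_mul_apply (q : ℂ) (Z : Matrix (Fin n × Fin n) (Fin n × Fin n) ℂ) (a b : Fin n)
    (y : Fin n × Fin n) :
    (Rcheck q n * Z) (a, b) y = rAct q (· < ·) (fun c d => Z (c, d) y) b a := by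
  simp only [Matrix.mul_apply, Rcheck_apply, Rmat_eq_rGen]
  rw [sum_rGen_mul, rAct]

lemma mul_Rcheck_apply (q : ℂ) (Z : Matrix (Fin n × Fin n) (Fin n × Fin n) ℂ)
    (x : Fin n × Fin n) (d e : Fin n) :
    (Z * Rcheck q n) x (d, e) = rAct q (· < ·) (fun a b => Z x (a, b)) e d := by
  rw [Matrix.mul_apply, rAct, ← sum_rGen_mul]
  refine Finset.sum_congr rfl fun y _ => ?_
  rw [Rcheck_apply, Rmat_eq_rGen, rGen_lt_symm, mul_comm]

lemma rAct_yangBaxter {q : ℂ} (hq : q ≠ 0) (f : Fin n → Fin n → Fin n → ℂ) (i b c : Fin n) :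
    rAct q (· < ·) (fun b' c' => rAct q (· < ·) (fun i' c'' => rAct q (· < ·)
        (fun i'' b'' => f i'' b'' c'') i' b') i c') c b =
      rAct q (· < ·) (fun i' c' => rAct q (· < ·) (fun i'' b' => rAct q (· < ·)
        (fun b'' c'' => f i'' b'' c'') c' b') i' b) i c := by
  rcases lt_trichotomy i b with h1 | h1 | h1 <;> rcases lt_trichotomy b c with h2 | h2 | h2 <;>
    rcases lt_trichotomy i c with h3 | h3 | h3 <;> first
    | (exfalso; order)
    | (simp [rAct, *, LT.lt.ne, LT.lt.ne', LT.lt.not_gt]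
       try field_simp
       try ring)

lemma rAct_yangBaxter_gt {q : ℂ} (hq : q ≠ 0) (f : Fin n → Fin n → Fin n → ℂ) (i b c : Fin n) :
    rAct q (· < ·) (fun b' c' => rAct q⁻¹ (· > ·) (fun i' c'' => rAct q⁻¹ (· > ·)
        (fun i'' b'' => f i'' b'' c'') i' b') i c') c b =
      rAct q⁻¹ (· > ·) (fun i' c' => rAct q⁻¹ (· > ·) (fun i'' b' => rAct q (· < ·)
        (fun b'' c'' => f i'' b'' c'') c' b') i' b) i c := by
  rcases lt_trichotomy i b with h1 | h1 | h1 <;> rcases lt_trichotomy b c with h2 | h2 | h2 <;>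
    rcases lt_trichotomy i c with h3 | h3 | h3 <;> first
    | (exfalso; order)
    | (simp [rAct, *, LT.lt.ne, LT.lt.ne', LT.lt.not_gt]
       try field_simp
       try ring)

lemma rAct_comm (t u : ℂ) (r s : Fin n → Fin n → Prop) (F : Fin n → Fin n → Fin n → Fin n → ℂ)
    (a b c d : Fin n) :
    rAct t r (fun a' b' => rAct u s (F a' b') c d) a b =
      rAct u s (fun c' d' => rAct t r (fun a' b' => F a' b' c' d') a b) c d := by
  simp only [rAct]
  ring

lemma Rcheck_commute_blockPair {q : ℂ} (t : ℂ) (r : Fin n → Fin n → Prop)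
    (h : ∀ (f : Fin n → Fin n → Fin n → ℂ) (i b c : Fin n),
      rAct q (· < ·) (fun b' c' => rAct t r (fun i' c'' => rAct t r
          (fun i'' b'' => f i'' b'' c'') i' b') i c') c b =
        rAct t r (fun i' c' => rAct t r (fun i'' b' => rAct q (· < ·)
          (fun b'' c'' => f i'' b'' c'') c' b') i' b) i c) (i k : Fin n) :
    Commute (Rcheck q n) (blockPair (rGen t r) i k) := by
  ext ⟨b, c⟩ ⟨d, e⟩
  have inner (i'' b' c' : Fin n) : rAct q (· < ·) (fun b'' c'' =>
      if i'' = k ∧ b'' = d ∧ c'' = e then (1 : ℂ) else 0) c' b' =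
      rAct q (· < ·) (fun d' e' => if i'' = k ∧ b' = d' ∧ c' = e' then (1 : ℂ) else 0) e d := by
    simp only [rAct]
    congr 1
    · by_cases hde : c' = d ∧ b' = e
      · obtain ⟨rfl, rfl⟩ := hde
        simp [eq_comm]
      · rw [if_neg (show ¬(i'' = k ∧ c' = d ∧ b' = e) by tauto),
          if_neg (show ¬(i'' = k ∧ b' = e ∧ c' = d) by tauto), mul_zero, mul_zero]
    · by_cases hde : b' = d ∧ c' = e
      · obtain ⟨rfl, rfl⟩ := hde
        simp
      · rw [if_neg (show ¬(i'' = k ∧ b' = d ∧ c' = e) by tauto), mul_zero, mul_zero]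
  rw [Rcheck_mul_apply, mul_Rcheck_apply]
  simp only [blockPair_apply]
  rw [h]
  simp only [inner]
  rw [rAct_comm]
  simp only [rAct_comm q t]

lemma sum_zpow_between {q : ℂ} (hq : q ≠ 0) (s p : Fin n) (hsp : s < p) :
    ∑ a : Fin n, (if s < a ∧ a < p then (q - q⁻¹) * q ^ (-2 * ((a : ℕ) : ℤ)) else 0) =
      q⁻¹ * q ^ (-2 * ((s : ℕ) : ℤ)) - q * q ^ (-2 * ((p : ℕ) : ℤ)) := by
  have tele (c d : ℕ) (hcd : c ≤ d) :
      ∑ a ∈ Finset.Ico c d, (q - q⁻¹) * q ^ (-2 * (a : ℤ)) =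
        q * q ^ (-2 * (c : ℤ)) - q * q ^ (-2 * (d : ℤ)) := by
    induction d, hcd using Nat.le_induction with
    | base => simp
    | succ d hd ih =>
      rw [Finset.sum_Ico_succ_top hd, ih, Nat.cast_succ, mul_add, zpow_add₀ hq]
      have : q * q ^ (-2 * 1 : ℤ) = q⁻¹ := by
        rw [← zpow_one_add₀ hq]
        norm_num
      linear_combination (q ^ (-2 * (d : ℤ))) * this
  have hs : q⁻¹ * q ^ (-2 * ((s : ℕ) : ℤ)) = q * q ^ (-2 * (((s : ℕ) + 1 : ℕ) : ℤ)) := by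
    rw [← zpow_neg_one, ← zpow_add₀ hq, ← zpow_one_add₀ hq]
    congr 1
    push_cast
    ring
  rw [hs, ← tele _ _ hsp, ← Finset.sum_filter]
  refine Finset.sum_bij (fun a _ => (a : ℕ)) ?_ ?_ ?_ ?_
  · intro a ha
    rw [Finset.mem_filter] at ha
    exact Finset.mem_Ico.2 ⟨ha.2.1, ha.2.2⟩
  · intro a _ b _ hab
    exact Fin.ext hab
  · intro b hb
    rw [Finset.mem_Ico] at hb
    refine ⟨⟨b, hb.2.trans p.2⟩, ?_, rfl⟩
    exact Finset.mem_filter.2 ⟨Finset.mem_univ _, hb.1, hb.2⟩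
  · intro a _
    rfl

lemma rGen_trace {t : ℂ} (ht : t ≠ 0) (r : Fin n → Fin n → Prop) (hr : ∀ a, ¬ r a a)
    (htrans : ∀ a b c, r a b → r b c → r a c) (d : Fin n → ℂ)
    (hd : ∀ s p, r s p → ∑ a, (if r s a ∧ r a p then (t - t⁻¹) * d a else 0) =
      t⁻¹ * d s - t * d p) (s p b c : Fin n) :
    ∑ j, ∑ a, rGen t r (j, c) (p, a) * d a * rGen t⁻¹ r (s, a) (j, b) =
      if s = p ∧ c = b then d b else 0 := by
  have col (f : Fin n → Fin n → ℂ) : ∑ j, ∑ a, rGen t r (j, c) (p, a) * f j a =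
      (if p = c then t else 1) * f p c +
        if c = p then ∑ a, (if r a p then t - t⁻¹ else 0) * f a a else 0 := by
    have h (j a : Fin n) : rGen t r (j, c) (p, a) * f j a =
        (if j = p then if a = c then (if p = c then t else 1) * f p c else 0 else 0) +
          if j = a then if c = p then (if r a p then t - t⁻¹ else 0) * f a a else 0 else 0 := by
      simp only [rGen, add_mul]
      congr 1
      · by_cases h1 : j = p <;> by_cases h2 : c = a <;> simp_all [eq_comm]
      · by_cases h1 : j = a <;> by_cases h2 : c = p <;> simp_all
    simp only [h, Finset.sum_add_distrib]
    by_cases hcp : c = p <;> simp [hcp]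
  simp only [mul_assoc]
  rw [col]
  by_cases hcp : c = p
  · subst hcp
    by_cases hsb : s = b
    · subst hsb
      have hsum : ∑ a, (if r a c then t - t⁻¹ else 0) * (d a * rGen t⁻¹ r (s, a) (a, s)) =
          (if r s c then t - t⁻¹ else 0) * (d s * t⁻¹) -
            (t - t⁻¹) * ∑ a, (if r s a ∧ r a c then (t - t⁻¹) * d a else 0) := by
        have h (a : Fin n) : (if r a c then t - t⁻¹ else 0) * (d a * rGen t⁻¹ r (s, a) (a, s)) =
            (if a = s then (if r s c then t - t⁻¹ else 0) * (d s * t⁻¹) else 0) -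
              (t - t⁻¹) * (if r s a ∧ r a c then (t - t⁻¹) * d a else 0) := by
          simp only [rGen, inv_inv]
          by_cases h1 : a = s
          · subst h1
            simp [hr]
          · by_cases h2 : r a c <;> by_cases h3 : r s a <;> simp [h1, h2, h3, Ne.symm h1]
            ring
        simp only [h, Finset.sum_sub_distrib, ← Finset.mul_sum]
        simp
      rw [if_pos rfl, if_pos rfl, hsum]
      simp only [rGen, inv_inv]
      by_cases hsc : r s c
      · have hne : s ≠ c := fun h => hr c (h ▸ hsc)
        rw [hd s c hsc]
        simp only [hne, hsc, hne.symm, if_true, if_false, and_false]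
        simp
        ring
      · have h0 (a : Fin n) : ¬(r s a ∧ r a c) := fun h => hsc (htrans _ _ _ h.1 h.2)
        rw [Finset.sum_eq_zero fun a _ => if_neg (h0 a)]
        by_cases hse : s = c
        · subst hse
          simp [hr]
          field_simp
        · simp [hsc, hse, Ne.symm hse]
    · have h1 (a : Fin n) : rGen t⁻¹ r (s, a) (a, b) = 0 := by
        simp only [rGen, hsb, and_false, if_false, mul_zero, add_zero]
        exact mul_eq_zero_of_right _ (if_neg fun h => hsb (h.1.trans h.2))
      have h2 : ¬(s = c ∧ c = b) := fun h => hsb (h.1.trans h.2)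
      simp [h1, h2]
  · by_cases h : s = p ∧ c = b
    · obtain ⟨rfl, rfl⟩ := h
      simp [rGen, hcp, Ne.symm hcp]
    · simp only [rGen]
      simp [hcp, Ne.symm hcp, h]

lemma rGen_lt_trace {q : ℂ} (hq : q ≠ 0) (s p b c : Fin n) :
    ∑ j, ∑ a, rGen q (· < ·) (j, c) (p, a) * q ^ (-2 * ((a : ℕ) : ℤ)) *
      rGen q⁻¹ (· < ·) (s, a) (j, b) = if s = p ∧ c = b then q ^ (-2 * ((b : ℕ) : ℤ)) else 0 := by
  refine rGen_trace hq (· < ·) lt_irrefl (fun _ _ _ => lt_trans)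
    (fun a => q ^ (-2 * ((a : ℕ) : ℤ))) (fun s p hsp => ?_) s p b c
  rw [← sum_zpow_between hq s p hsp]
  congr!

lemma rGen_gt_trace {q : ℂ} (hq : q ≠ 0) (s p b c : Fin n) :
    ∑ j, ∑ a, rGen q⁻¹ (· > ·) (j, c) (p, a) * q ^ (-2 * ((a : ℕ) : ℤ)) *
      rGen q⁻¹⁻¹ (· > ·) (s, a) (j, b) = if s = p ∧ c = b then q ^ (-2 * ((b : ℕ) : ℤ)) else 0 := by
  refine rGen_trace (inv_ne_zero hq) (· > ·) lt_irrefl (fun _ _ _ => gt_trans)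
    (fun a => q ^ (-2 * ((a : ℕ) : ℤ))) (fun s p hsp => ?_) s p b c
  rw [inv_inv, ← neg_sub (q⁻¹ * _), ← sum_zpow_between hq p s hsp, ← Finset.sum_neg_distrib]
  refine Finset.sum_congr rfl fun a _ => ?_
  simp only [gt_iff_lt, and_comm (a := a < s)]
  split_ifs <;> ring

end RMatrix

section Monodromy

variable {n m : ℕ}

/-- The `(i, j)` block of an element of `End ℂⁿ ⊗ End ℂⁿ ⊗ A` with respect to the first leg. -/
def block {A : Type} (M : Matrix (Fin n × Fin n) (Fin n × Fin n) A) (i j : Fin n) :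
    Matrix (Fin n) (Fin n) A :=
  Matrix.of fun b d => M (i, b) (j, d)

lemma block_apply {A : Type} (M : Matrix (Fin n × Fin n) (Fin n × Fin n) A) (i j b d : Fin n) :
    block M i j b d = M (i, b) (j, d) := rfl

variable {A : Type} [Ring A]

lemma block_mul (M N : Matrix (Fin n × Fin n) (Fin n × Fin n) A) (i k : Fin n) :
    block (M * N) i k = ∑ j, block M i j * block N j k := by
  ext b d
  rw [Matrix.sum_apply, block_apply, Matrix.mul_apply, Fintype.sum_prod_type]
  exact Finset.sum_congr rfl fun j _ => by rw [Matrix.mul_apply]; rfl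

/-- An element of `End ℂⁿ ⊗ End ℂⁿ ⊗ A` with its first leg realized as an auxiliary `n×n` block
structure and its second one placed in the tensor leg `a`. -/
def blockLeg (m : ℕ) (M : Matrix (Fin n × Fin n) (Fin n × Fin n) A) (a : ℕ) :
    Matrix (Fin n) (Fin n) (TMat A n m) :=
  Matrix.of fun i j => leg1 n m (block M i j) a

lemma blockLeg_apply (M : Matrix (Fin n × Fin n) (Fin n × Fin n) A) (a : ℕ) (i j : Fin n) :
    blockLeg m M a i j = leg1 n m (block M i j) a := rfl

lemma blockLeg_mul (M N : Matrix (Fin n × Fin n) (Fin n × Fin n) A) (a : Fin m) :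
    blockLeg m (M * N) a = blockLeg m M a * blockLeg m N a := by
  ext1 i k
  rw [Matrix.mul_apply]
  simp only [blockLeg_apply, ← leg1Hom_apply, ← map_mul, ← map_sum, block_mul]

lemma leg1_scalar (x : A) (a : Fin m) :
    leg1 n m (Matrix.scalar (Fin n) x) a = Matrix.scalar (Fin m → Fin n) x := by
  ext i j
  rw [leg1_apply, Matrix.scalar_apply, Matrix.scalar_apply, Matrix.diagonal_apply,
    Matrix.diagonal_apply]
  by_cases h : i = j
  · simp [h]
  · rw [if_neg h]
    split_ifs with h1 h2
    · refine absurd (funext fun c => ?_) h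
      by_cases hc : c = a
      · rw [hc, h2]
      · exact h1 c hc
    · rfl
    · rfl

lemma blockLeg_M1 (X : Matrix (Fin n) (Fin n) A) (a : Fin m) :
    blockLeg m (M1 X) a = X.map (Matrix.scalar (Fin m → Fin n)) := by
  ext1 i k
  rw [Matrix.map_apply, ← leg1_scalar _ a, blockLeg_apply]
  congr 1

lemma blockLeg_M2 (X : Matrix (Fin n) (Fin n) A) (a : Fin m) :
    blockLeg m (M2 X) a = Matrix.scalar (Fin n) (leg1 n m X a) := by
  ext1 i k
  rw [Matrix.scalar_apply, Matrix.diagonal_apply, ← leg1Hom_apply]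
  have hb : block (M2 X) i k = if i = k then X else 0 := by
    ext b d
    simp only [block_apply, M2]
    split_ifs <;> rfl
  rw [blockLeg_apply, hb, ← leg1Hom_apply]
  split_ifs
  · rfl
  · rw [map_zero]

lemma M2_one : M2 (1 : Matrix (Fin n) (Fin n) A) = 1 := by
  ext ⟨a, b⟩ ⟨c, d⟩
  simp only [M2, Matrix.one_apply, Prod.mk.injEq, ite_and]

lemma blockLeg_one (a : Fin m) :
    blockLeg m (1 : Matrix (Fin n × Fin n) (Fin n × Fin n) A) a = 1 := by
  rw [← M2_one, blockLeg_M2, ← leg1Hom_apply, map_one, map_one]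

lemma scalar_commute_of_forall {ι R : Type} [Fintype ι] [DecidableEq ι] [Ring R] {y : R}
    {Z : Matrix ι ι R} (h : ∀ i j, Commute y (Z i j)) : Commute (Matrix.scalar ι y) Z := by
  ext i j
  rw [Matrix.scalar_apply, Matrix.diagonal_mul, Matrix.mul_diagonal, (h i j).eq]

lemma commute_of_scalar_commute {ι R : Type} [Fintype ι] [DecidableEq ι] [Ring R] {y : R}
    {Z : Matrix ι ι R} (h : Commute (Matrix.scalar ι y) Z) (i j : ι) : Commute y (Z i j) := by
  have := congrFun (congrFun h.eq i) j
  rwa [Matrix.scalar_apply, Matrix.diagonal_mul, Matrix.mul_diagonal] at this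

/-- The product `S_{0a} ⋯ S_{02} S_{01}`, with the auxiliary leg `0` as the block structure. -/
def monodromy (m : ℕ) (S : Matrix (Fin n × Fin n) (Fin n × Fin n) ℂ) :
    ℕ → Matrix (Fin n) (Fin n) (TMat ℂ n m)
  | 0 => 1
  | a + 1 => blockLeg m S a * monodromy m S a

/-- The product `S_{01} S_{02} ⋯ S_{0a}`, with the auxiliary leg `0` as the block structure. -/
def monodromyRev (m : ℕ) (S : Matrix (Fin n × Fin n) (Fin n × Fin n) ℂ) :
    ℕ → Matrix (Fin n) (Fin n) (TMat ℂ n m)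
  | 0 => 1
  | a + 1 => monodromyRev m S a * blockLeg m S a

variable {S S' : Matrix (Fin n × Fin n) (Fin n × Fin n) ℂ}

lemma monodromyRev_mul_monodromy (h : S' * S = 1) (a : ℕ) (ha : a ≤ m) :
    monodromyRev m S' a * monodromy m S a = 1 := by
  induction a with
  | zero => simp [monodromy, monodromyRev]
  | succ a ih =>
    have key := blockLeg_mul S' S (⟨a, ha⟩ : Fin m)
    rw [h, blockLeg_one] at key
    rw [monodromy, monodromyRev, mul_assoc, ← mul_assoc (blockLeg m S' a), ← key, one_mul,
      ih (by omega)]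

lemma leg1_commute_blockLeg (X : Matrix (Fin n) (Fin n) ℂ) {a b : Fin m} (hab : a ≠ b)
    (M : Matrix (Fin n × Fin n) (Fin n × Fin n) ℂ) :
    Commute (Matrix.scalar (Fin n) (leg1 n m X a)) (blockLeg m M b) :=
  scalar_commute_of_forall fun _ _ => leg1_commute_leg1 hab fun _ _ _ _ => Commute.all _ _

lemma leg1_commute_monodromy (X : Matrix (Fin n) (Fin n) ℂ) (c : Fin m) (a : ℕ) (ha : a ≤ c) :
    Commute (Matrix.scalar (Fin n) (leg1 n m X c)) (monodromy m S a) := by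
  induction a with
  | zero => exact Commute.one_right _
  | succ a ih =>
    refine (leg1_commute_blockLeg X (b := ⟨a, by omega⟩) ?_ S).mul_right (ih (by omega))
    exact fun h => by simp [h] at ha

lemma leg1_commute_monodromyRev (X : Matrix (Fin n) (Fin n) ℂ) (c : Fin m) (a : ℕ) (ha : a ≤ c) :
    Commute (Matrix.scalar (Fin n) (leg1 n m X c)) (monodromyRev m S a) := by
  induction a with
  | zero => exact Commute.one_right _
  | succ a ih =>
    refine (ih (by omega)).mul_right (leg1_commute_blockLeg X (b := ⟨a, by omega⟩) ?_ S)
    exact fun h => by simp [h] at ha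

lemma leg2_commute_blockLeg (C M : Matrix (Fin n × Fin n) (Fin n × Fin n) ℂ) {a b c : Fin m}
    (hab : a ≠ b) (hca : c ≠ a) (hcb : c ≠ b) :
    Commute (Matrix.scalar (Fin n) (leg2 ℂ n m C a b)) (blockLeg m M c) :=
  scalar_commute_of_forall fun _ _ => leg2_commute_leg1 C hab hca hcb _

lemma blockLeg_mul_blockLeg_apply {a b : Fin m} (hab : a ≠ b) (i k : Fin n) :
    (blockLeg m S b * blockLeg m S a) i k = leg2 ℂ n m (blockPair S i k) a b := by
  ext x y
  rw [Matrix.mul_apply, Matrix.sum_apply, leg2_apply]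
  simp only [blockLeg_apply, leg1_mul_leg1_apply hab.symm, block_apply, blockPair]
  by_cases h : ∀ c, c ≠ a → c ≠ b → x c = y c
  · simp only [if_pos h, if_pos fun c hb ha => h c ha hb]
    rfl
  · rw [if_neg h]
    refine Finset.sum_eq_zero fun j _ => if_neg fun h' => h fun c ha hb => h' c hb ha

lemma leg2_commute_monodromy {C : Matrix (Fin n × Fin n) (Fin n × Fin n) ℂ}
    (hC : ∀ i k, Commute C (blockPair S i k)) {k : ℕ} (hk : k + 1 < m) :
    Commute (Matrix.scalar (Fin n) (leg2 ℂ n m C k (k + 1))) (monodromy m S m) := by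
  let a : Fin m := ⟨k, by omega⟩
  let b : Fin m := ⟨k + 1, hk⟩
  have hab : a ≠ b := by simp [a, b]
  have step (c : ℕ) (hc : c < m) (hca : c ≠ k) (hcb : c ≠ k + 1)
      (h : Commute (Matrix.scalar (Fin n) (leg2 ℂ n m C k (k + 1))) (monodromy m S c)) :
      Commute (Matrix.scalar (Fin n) (leg2 ℂ n m C k (k + 1))) (monodromy m S (c + 1)) :=
    (leg2_commute_blockLeg C S (a := a) (b := b) (c := ⟨c, hc⟩) hab
      (fun h => hca (congrArg Fin.val h)) (fun h => hcb (congrArg Fin.val h))).mul_right h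
  have below (c : ℕ) (hc : c ≤ k) :
      Commute (Matrix.scalar (Fin n) (leg2 ℂ n m C k (k + 1))) (monodromy m S c) := by
    induction c with
    | zero => exact Commute.one_right _
    | succ c ih => exact step c (by omega) (by omega) (by omega) (ih (by omega))
  have above (c : ℕ) (hc : k + 2 ≤ c) (hcm : c ≤ m) :
      Commute (Matrix.scalar (Fin n) (leg2 ℂ n m C k (k + 1))) (monodromy m S c) := by
    induction c, hc using Nat.le_induction with
    | base =>
      rw [monodromy, monodromy, ← mul_assoc]
      refine Commute.mul_right (scalar_commute_of_forall fun i j => ?_) (below k le_rfl)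
      have := blockLeg_mul_blockLeg_apply (S := S) hab i j
      simp only [a, b] at this
      rw [this]
      change leg2 ℂ n m C a b * leg2 ℂ n m _ a b = leg2 ℂ n m _ a b * leg2 ℂ n m C a b
      rw [leg2_mul_leg2 _ _ hab, leg2_mul_leg2 _ _ hab, (hC i j).eq]
    | succ c hc ih => exact step c (by omega) (by omega) (by omega) (ih (by omega))
  exact above m hk le_rfl

lemma leg1_trace (d : Fin n → ℂ)
    (htr : ∀ s p b c, ∑ j, ∑ a, S (j, c) (p, a) * d a * S' (s, a) (j, b) =
      if s = p ∧ c = b then d b else 0) (a : Fin m) (p r : Fin n) :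
    ∑ j, blockLeg m S a j p * Matrix.diagonal (fun x => ∏ c, d (x c)) * blockLeg m S' a r j =
      if r = p then Matrix.diagonal (fun x => ∏ c, d (x c)) else 0 := by
  let D' : TMat ℂ n m := Matrix.diagonal fun x => ∏ c ∈ Finset.univ.erase a, d (x c)
  have hD : Matrix.diagonal (fun x => ∏ c, d (x c)) = leg1 n m (Matrix.diagonal d) a * D' := by
    ext x y
    rw [Matrix.mul_diagonal, leg1_apply, Matrix.diagonal_apply, Matrix.diagonal_apply]
    by_cases h : x = y
    · subst h
      simp only [if_true, implies_true]
      exact (Finset.mul_prod_erase _ _ (Finset.mem_univ a)).symm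
    · rw [if_neg h]
      split_ifs with h1 h2
      · refine absurd (funext fun c => ?_) h
        by_cases hc : c = a
        · rw [hc, h2]
        · exact h1 c hc
      · simp
      · simp
  have hD' (X : Matrix (Fin n) (Fin n) ℂ) : Commute D' (leg1 n m X a) := by
    refine diagonal_commute_leg1 _ (fun _ _ => Commute.all _ _) a (fun x y => ?_) X
    refine Finset.prod_congr rfl fun c hc => ?_
    rw [Function.update_of_ne (Finset.ne_of_mem_erase hc)]
  have hterm (j : Fin n) : blockLeg m S a j p * Matrix.diagonal (fun x => ∏ c, d (x c)) *
      blockLeg m S' a r j = leg1Hom ℂ n a (block S j p * Matrix.diagonal d * block S' r j) * D' := by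
    rw [hD, map_mul, map_mul]
    simp only [blockLeg_apply, leg1Hom_apply, mul_assoc, (hD' _).eq]
  rw [Finset.sum_congr rfl fun j _ => hterm j, ← Finset.sum_mul, ← map_sum]
  have hsum : ∑ j, block S j p * Matrix.diagonal d * block S' r j =
      if r = p then Matrix.diagonal d else 0 := by
    ext c b
    rw [Matrix.sum_apply]
    rw [Finset.sum_congr rfl fun j _ => Matrix.mul_apply]
    simp only [Matrix.mul_diagonal, block_apply]
    rw [htr]
    by_cases h : r = p
    · simp only [h, true_and, if_true, Matrix.diagonal_apply]
      by_cases hcb : c = b <;> simp [hcb]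
    · simp [h]
  rw [hsum]
  split_ifs
  · rw [hD]; rfl
  · rw [map_zero, zero_mul]

lemma monodromy_trace (d : Fin n → ℂ)
    (htr : ∀ s p b c, ∑ j, ∑ a, S (j, c) (p, a) * d a * S' (s, a) (j, b) =
      if s = p ∧ c = b then d b else 0) (a : ℕ) (ha : a ≤ m) (i k : Fin n) :
    ∑ j, monodromy m S a j k * Matrix.diagonal (fun x => ∏ c, d (x c)) * monodromyRev m S' a i j =
      if i = k then Matrix.diagonal (fun x => ∏ c, d (x c)) else 0 := by
  induction a generalizing i k with
  | zero =>
    simp only [monodromy, monodromyRev, Matrix.one_apply]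
    by_cases h : i = k
    · subst h
      simp
    · simp [h]
  | succ a ih =>
    let c : Fin m := ⟨a, ha⟩
    set D : TMat ℂ n m := Matrix.diagonal (fun x => ∏ c, d (x c)) with hD
    have hterm (j : Fin n) : monodromy m S (a + 1) j k * D * monodromyRev m S' (a + 1) i j =
        ∑ p, ∑ r, monodromy m S a p k * (blockLeg m S c j p * D * blockLeg m S' c r j) *
          monodromyRev m S' a i r := by
      rw [monodromy, monodromyRev, Matrix.mul_apply, Matrix.mul_apply, Finset.sum_mul,
        Finset.sum_mul_sum]
      refine Finset.sum_congr rfl fun p _ => Finset.sum_congr rfl fun r _ => ?_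
      have h1 : Commute (blockLeg m S a j p) (monodromy m S a p k) :=
        commute_of_scalar_commute (leg1_commute_monodromy _ c a le_rfl) _ _
      have h2 : Commute (blockLeg m S' a r j) (monodromyRev m S' a i r) :=
        commute_of_scalar_commute (leg1_commute_monodromyRev _ c a le_rfl) _ _
      rw [h1.eq, ← h2.eq]
      simp only [mul_assoc, c]
    rw [Finset.sum_congr rfl fun j _ => hterm j, Finset.sum_comm,
      Finset.sum_congr rfl fun p _ => Finset.sum_comm]
    simp only [← Finset.sum_mul, ← Finset.mul_sum, hD, leg1_trace d htr]
    rw [← ih (by omega) i k]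
    simp [hD]

end Monodromy

section Centrality

variable {A : Type} [Ring A] [Algebra ℂ A] {n m : ℕ}

/-- Extension of scalars from `ℂ` to `A`. -/
def baseChange (A : Type) [Ring A] [Algebra ℂ A] (n m : ℕ) : TMat ℂ n m →+* TMat A n m :=
  (algebraMap ℂ A).mapMatrix

lemma baseChange_apply (Y : TMat ℂ n m) (i j : Fin m → Fin n) :
    baseChange A n m Y i j = algebraMap ℂ A (Y i j) := rfl

lemma baseChange_leg2 (C : Matrix (Fin n × Fin n) (Fin n × Fin n) ℂ) (a b : ℕ) :
    baseChange A n m (leg2 ℂ n m C a b) = leg2 A n m C a b := by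
  ext i j
  simp only [baseChange_apply, leg2]
  split_ifs <;> simp

lemma baseChange_blockLeg (S : Matrix (Fin n × Fin n) (Fin n × Fin n) ℂ) (a : ℕ) :
    (baseChange A n m).mapMatrix (blockLeg m S a) = blockLeg m (S.map (algebraMap ℂ A)) a := by
  ext i j x y
  rw [RingHom.mapMatrix_apply, Matrix.map_apply, baseChange_apply, blockLeg_apply, blockLeg_apply]
  simp only [leg1]
  split_ifs
  · rfl
  · simp
  · simp

lemma baseChange_commute_scalar (Y : TMat ℂ n m) (x : A) :
    Commute (baseChange A n m Y) (Matrix.scalar (Fin m → Fin n) x) := by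
  ext i j
  rw [Matrix.scalar_apply, Matrix.diagonal_mul, Matrix.mul_diagonal, baseChange_apply,
    Algebra.commutes]

lemma trace_baseChange_mul_comm (Z : TMat ℂ n m) (Y : TMat A n m) :
    Matrix.trace (baseChange A n m Z * Y) = Matrix.trace (Y * baseChange A n m Z) := by
  simp only [Matrix.trace, Matrix.diag_apply, Matrix.mul_apply, baseChange_apply,
    Algebra.commutes]
  exact Finset.sum_comm

/-- The weight operator `D₁ ⋯ D_m`. -/
def weightD (q : ℂ) (n m : ℕ) : TMat ℂ n m :=
  Matrix.diagonal fun x => ∏ c, q ^ (-2 * ((x c : ℕ) : ℤ))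

lemma qTr_eq_trace (q : ℂ) (Y : TMat A n m) :
    qTr q n m Y = Matrix.trace (baseChange A n m (weightD q n m) * Y) := by
  have h : baseChange A n m (weightD q n m) =
      Matrix.diagonal fun x => algebraMap ℂ A (∏ c, q ^ (-2 * ((x c : ℕ) : ℤ))) :=
    Matrix.diagonal_map (map_zero _)
  rw [h, qTr]
  simp only [Matrix.trace, Matrix.diag_apply, Matrix.diagonal_mul]

lemma qTr_sum {ι : Type} (s : Finset ι) (q : ℂ) (f : ι → TMat A n m) :
    qTr q n m (∑ j ∈ s, f j) = ∑ j ∈ s, qTr q n m (f j) := by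
  simp only [qTr_eq_trace, Finset.mul_sum, Matrix.trace_sum]

lemma qTr_scalar_mul (q : ℂ) (x : A) (Y : TMat A n m) :
    qTr q n m (Matrix.scalar _ x * Y) = x * qTr q n m Y := by
  simp only [qTr, Finset.mul_sum, Matrix.scalar_apply, Matrix.diagonal_mul]
  refine Finset.sum_congr rfl fun i _ => ?_
  rw [← mul_assoc, ← mul_assoc, Algebra.commutes]

lemma qTr_mul_scalar (q : ℂ) (x : A) (Y : TMat A n m) :
    qTr q n m (Y * Matrix.scalar _ x) = qTr q n m Y * x := by
  simp only [qTr, Finset.sum_mul, Matrix.scalar_apply, Matrix.mul_diagonal, mul_assoc]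

variable {q : ℂ} {S S' : Matrix (Fin n × Fin n) (Fin n × Fin n) ℂ}

lemma qTr_conj_monodromy
    (htr : ∀ s p b c, ∑ j, ∑ a, S (j, c) (p, a) * q ^ (-2 * ((a : ℕ) : ℤ)) * S' (s, a) (j, b) =
      if s = p ∧ c = b then q ^ (-2 * ((b : ℕ) : ℤ)) else 0) (Y : TMat A n m) (i j : Fin n) :
    ∑ p, qTr q n m (baseChange A n m (monodromyRev m S' m i p) * Y *
      baseChange A n m (monodromy m S m p j)) = if i = j then qTr q n m Y else 0 := by
  have hterm (p : Fin n) : qTr q n m (baseChange A n m (monodromyRev m S' m i p) * Y *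
      baseChange A n m (monodromy m S m p j)) = Matrix.trace (Y * baseChange A n m
        (monodromy m S m p j * weightD q n m * monodromyRev m S' m i p)) := by
    rw [qTr_eq_trace, mul_assoc, ← mul_assoc, ← map_mul, trace_baseChange_mul_comm, mul_assoc,
      ← map_mul, ← mul_assoc]
  rw [Finset.sum_congr rfl fun p _ => hterm p, ← Matrix.trace_sum, ← Finset.mul_sum, ← map_sum]
  have key := monodromy_trace (fun a : Fin n => q ^ (-2 * ((a : ℕ) : ℤ))) htr m le_rfl i j
  rw [show ∑ p, monodromy m S m p j * weightD q n m * monodromyRev m S' m i p =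
    if i = j then weightD q n m else 0 from key]
  split_ifs
  · rw [qTr_eq_trace, trace_baseChange_mul_comm]
  · simp

/-- The operator `S_{0m} ⋯ S_{01} T₀` through which the entries of `T` act on the tensor legs. -/
def transfer (m : ℕ) (S : Matrix (Fin n × Fin n) (Fin n × Fin n) ℂ)
    (T : Matrix (Fin n) (Fin n) A) (a : ℕ) : Matrix (Fin n) (Fin n) (TMat A n m) :=
  (baseChange A n m).mapMatrix (monodromy m S a) * T.map (Matrix.scalar _)

lemma baseChange_commute_transfer {Y : TMat ℂ n m}
    (hY : Commute (Matrix.scalar (Fin n) Y) (monodromy m S m)) (T : Matrix (Fin n) (Fin n) A) :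
    Commute (Matrix.scalar (Fin n) (baseChange A n m Y)) (transfer m S T m) := by
  refine Commute.mul_right ?_ (scalar_commute_of_forall fun i j => baseChange_commute_scalar Y _)
  have := hY.map (baseChange A n m).mapMatrix
  rwa [Matrix.scalar_apply, RingHom.mapMatrix_apply, Matrix.diagonal_map (map_zero _)] at this

lemma leg1_commute_transfer {T X : Matrix (Fin n) (Fin n) A}
    (hX : Commute (S.map (algebraMap ℂ A) * M1 T) (M2 X)) (hm : 0 < m) :
    Commute (Matrix.scalar (Fin n) (leg1 n m X 0)) (transfer m S T m) := by
  have h (a : ℕ) (ha : a < m) :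
      Commute (Matrix.scalar (Fin n) (leg1 n m X 0)) (transfer m S T (a + 1)) := by
    induction a with
    | zero =>
      have h0 (c : Fin m) : blockLeg m (S.map (algebraMap ℂ A) * M1 T * M2 X) c =
          blockLeg m (M2 X * (S.map (algebraMap ℂ A) * M1 T)) c := by rw [hX.eq]
      simp only [blockLeg_mul, blockLeg_M1, blockLeg_M2] at h0
      rw [transfer, monodromy, monodromy, mul_one, baseChange_blockLeg]
      exact (h0 ⟨0, hm⟩).symm
    | succ a ih =>
      rw [transfer, monodromy, map_mul, mul_assoc, baseChange_blockLeg]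
      refine Commute.mul_right (scalar_commute_of_forall fun i j => ?_) (ih (by omega))
      refine leg1_commute_leg1 (a := ⟨0, hm⟩) (b := ⟨a + 1, ha⟩) ?_ fun _ _ _ _ => ?_
      · simp
      · exact (Algebra.commutes _ _).symm
  obtain ⟨a, rfl⟩ := Nat.exists_eq_succ_of_ne_zero hm.ne'
  exact h a (Nat.lt_succ_self a)

lemma inv_commute {ι : Type} [Fintype ι] [DecidableEq ι] {C Z : Matrix ι ι ℂ}
    (h : Commute C Z) : Commute C⁻¹ Z := by
  by_cases hu : IsUnit C
  · obtain ⟨C, rfl⟩ := hu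
    rw [← Matrix.coe_units_inv]
    exact h.units_inv_left
  · rw [Matrix.nonsing_inv_apply_not_isUnit C ((Matrix.isUnit_iff_isUnit_det C).not.1 hu)]
    exact Commute.zero_left Z

lemma legBar_commute_transfer (hC : ∀ i k, Commute (Rcheck q n) (blockPair S i k))
    {T X : Matrix (Fin n) (Fin n) A} (hX : Commute (S.map (algebraMap ℂ A) * M1 T) (M2 X))
    (k : ℕ) (hk : k < m) :
    Commute (Matrix.scalar (Fin n) (legBar q n m X k)) (transfer m S T m) := by
  induction k with
  | zero => exact leg1_commute_transfer hX hk
  | succ k ih =>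
    rw [legBar, RcLeg, RcLegInv, ← baseChange_leg2 (Rcheck q n), ← baseChange_leg2 (Rcheck q n)⁻¹,
      map_mul, map_mul]
    refine Commute.mul_left (Commute.mul_left ?_ (ih (by omega))) ?_
    · exact baseChange_commute_transfer (leg2_commute_monodromy hC hk) T
    · exact baseChange_commute_transfer
        (leg2_commute_monodromy (fun i k => inv_commute (hC i k)) hk) T

lemma heckeRep_commute_monodromy (hC : ∀ i k, Commute (Rcheck q n) (blockPair S i k))
    {φ : Hecke q m →ₐ[ℂ] TMat ℂ n m} (hφ : IsHeckeRep q n m φ) (e : Hecke q m) :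
    Commute (Matrix.scalar (Fin n) (φ e)) (monodromy m S m) := by
  obtain ⟨x, rfl⟩ := RingQuot.mkAlgHom_surjective ℂ (HeckeRel q m) e
  induction x using FreeAlgebra.induction with
  | grade0 r =>
    rw [AlgHom.commutes, AlgHom.commutes]
    exact scalar_commute_of_forall fun _ _ => Algebra.commutes r _
  | grade1 i =>
    have h := hφ i i.2
    rw [Tn, dif_pos i.2, Tgen] at h
    rw [h]
    exact leg2_commute_monodromy hC (by omega)
  | mul x y hx hy =>
    rw [map_mul, map_mul, map_mul]
    exact hx.mul_left hy
  | add x y hx hy =>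
    rw [map_add, map_add, map_add]
    exact hx.add_left hy

lemma prodU_commute_transfer (hC : ∀ i k, Commute (Rcheck q n) (blockPair S i k))
    {T X : Matrix (Fin n) (Fin n) A} (hX : Commute (S.map (algebraMap ℂ A) * M1 T) (M2 X))
    {μ : YoungDiagram} (U : StdTab μ m) {φ : Hecke q m →ₐ[ℂ] TMat ℂ n m}
    (hφ : IsHeckeRep q n m φ) (e : Hecke q m) (z : ℂ) :
    Commute (Matrix.scalar (Fin n) (prodU q n m U (φ e) X z)) (transfer m S T m) := by
  rw [prodU, map_mul]
  refine Commute.mul_left ?_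
    (baseChange_commute_transfer (heckeRep_commute_monodromy hC hφ e) T)
  rw [map_list_prod, List.map_map]
  refine Commute.list_prod_left _ _ fun y hy => ?_
  obtain ⟨k, hk, rfl⟩ := List.mem_map.1 hy
  rw [Function.comp_apply, map_add]
  refine (legBar_commute_transfer hC hX k (List.mem_range.1 hk)).add_left ?_
  rw [show (Matrix.scalar (Fin n)) (((z * q ^ (-2 * ctnAt U (k + 1))) : ℂ) • (1 : TMat A n m)) =
    ((z * q ^ (-2 * ctnAt U (k + 1))) : ℂ) • 1 by
      ext i j : 2
      by_cases h : i = j <;> simp [h]]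
  exact (Commute.one_left _).smul_left _

theorem SUpoly_commute_of_exchange (hSS' : S * S' = 1)
    (hC : ∀ i k, Commute (Rcheck q n) (blockPair S i k))
    (htr : ∀ s p b c, ∑ j, ∑ a, S (j, c) (p, a) * q ^ (-2 * ((a : ℕ) : ℤ)) * S' (s, a) (j, b) =
      if s = p ∧ c = b then q ^ (-2 * ((b : ℕ) : ℤ)) else 0)
    {T X : Matrix (Fin n) (Fin n) A} (hX : Commute (S.map (algebraMap ℂ A) * M1 T) (M2 X))
    {μ : YoungDiagram} (U : StdTab μ m) {φ : Hecke q m →ₐ[ℂ] TMat ℂ n m}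
    (hφ : IsHeckeRep q n m φ) (e : Hecke q m) (z : ℂ) (i k : Fin n) :
    SUpoly q n m U (φ e) X z * T i k = T i k * SUpoly q n m U (φ e) X z := by
  set Y := prodU q n m U (φ e) X z with hY
  have hcomm := prodU_commute_transfer hC hX U hφ e z
  rw [← hY] at hcomm
  let u := (baseChange A n m).mapMatrix (monodromy m S m)
  let u' := (baseChange A n m).mapMatrix (monodromyRev m S' m)
  have hu : u' * u = 1 := by
    rw [← map_mul, monodromyRev_mul_monodromy (mul_eq_one_comm.1 hSS') m le_rfl, map_one]
  have hrel : T.map (Matrix.scalar (Fin m → Fin n)) * Matrix.scalar (Fin n) Y =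
      u' * Matrix.scalar (Fin n) Y * u * T.map (Matrix.scalar (Fin m → Fin n)) := by
    rw [mul_assoc _ u, mul_assoc u', show Matrix.scalar (Fin n) Y *
      (u * T.map (Matrix.scalar (Fin m → Fin n))) = _ from hcomm.eq, transfer, mul_assoc u,
      ← mul_assoc u', hu, one_mul]
  have hentry : Matrix.scalar (Fin m → Fin n) (T i k) * Y =
      ∑ j, (u' * Matrix.scalar (Fin n) Y * u) i j * Matrix.scalar (Fin m → Fin n) (T j k) :=
    (Matrix.mul_diagonal (fun _ => Y) (T.map (Matrix.scalar (Fin m → Fin n))) i k).symm.trans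
      ((congrFun (congrFun hrel i) k).trans Matrix.mul_apply)
  have hconj (j : Fin n) : (u' * Matrix.scalar (Fin n) Y * u) i j = ∑ p, u' i p * Y * u p j := by
    rw [Matrix.mul_apply]
    exact Finset.sum_congr rfl fun p _ => by rw [Matrix.scalar_apply, Matrix.mul_diagonal]
  have htrace := congrArg (qTr q n m) hentry
  rw [qTr_scalar_mul, qTr_sum] at htrace
  simp only [hconj, qTr_mul_scalar] at htrace
  rw [SUpoly, ← hY, htrace]
  have hq (j : Fin n) : qTr q n m (∑ p, u' i p * Y * u p j) = if i = j then qTr q n m Y else 0 :=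
    (qTr_sum ..).trans (qTr_conj_monodromy htr Y i j)
  simp only [hq, ite_mul, zero_mul, Finset.sum_ite_eq, Finset.mem_univ, if_true]

end Centrality

section Exchange

variable {n : ℕ}

lemma M2_mul {F : Type} [Ring F] (X Y : Matrix (Fin n) (Fin n) F) :
    M2 (X * Y) = M2 X * M2 Y := by
  ext ⟨a, b⟩ ⟨c, d⟩
  simp only [M2, Matrix.mul_apply, Fintype.sum_prod_type, ite_mul, zero_mul, mul_ite, mul_zero]
  by_cases h : a = c
  · subst h
    simp
  · simp [h]

lemma commute_mul_of_exchange {G : Type} [Monoid G] {s t p x k : G}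
    (hp : s * t * p = p * t * s) (hx : s * t * x = x * t * s) (hxk : x * k = 1)
    (hkx : k * x = 1) : Commute (s * t) (p * k) := by
  have h : k * (s * t) = t * s * k := by
    calc k * (s * t) = k * (s * t * x) * k := by rw [mul_assoc, mul_assoc, hxk, mul_one]
      _ = t * s * k := by rw [hx, ← mul_assoc, ← mul_assoc, hkx, one_mul]
  calc s * t * (p * k) = p * (t * s * k) := by rw [← mul_assoc, hp]; simp only [mul_assoc]
    _ = p * k * (s * t) := by rw [← h, mul_assoc]

variable {q : ℂ}

lemma rll_of_rel {X Y : Fin n → Fin n → FreeAlgebra ℂ (UqGen n)}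
    (h : ∀ x y, UqRel q n ((RmatU q n * M1 X * M2 Y) x y) ((M2 Y * M1 X * RmatU q n) x y)) :
    (Rmat q n).map (algebraMap ℂ (Uq q n)) *
        M1 (fun i j => RingQuot.mkAlgHom ℂ (UqRel q n) (X i j)) *
        M2 (fun i j => RingQuot.mkAlgHom ℂ (UqRel q n) (Y i j)) =
      M2 (fun i j => RingQuot.mkAlgHom ℂ (UqRel q n) (Y i j)) *
        M1 (fun i j => RingQuot.mkAlgHom ℂ (UqRel q n) (X i j)) *
        (Rmat q n).map (algebraMap ℂ (Uq q n)) := by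
  let π := (RingQuot.mkAlgHom ℂ (UqRel q n)).mapMatrix (m := Fin n × Fin n)
  have hR : π (RmatU q n) = (Rmat q n).map (algebraMap ℂ (Uq q n)) := by
    ext x y
    exact AlgHom.commutes _ _
  have h1 (X : Fin n → Fin n → FreeAlgebra ℂ (UqGen n)) :
      π (M1 X) = M1 (fun i j => RingQuot.mkAlgHom ℂ (UqRel q n) (X i j)) := by
    ext x y
    simp only [π, AlgHom.mapMatrix_apply, Matrix.map_apply, M1]
    split_ifs <;> simp
  have h2 (X : Fin n → Fin n → FreeAlgebra ℂ (UqGen n)) :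
      π (M2 X) = M2 (fun i j => RingQuot.mkAlgHom ℂ (UqRel q n) (X i j)) := by
    ext x y
    simp only [π, AlgHom.mapMatrix_apply, Matrix.map_apply, M2]
    split_ifs <;> simp
  have : π (RmatU q n * M1 X * M2 Y) = π (M2 Y * M1 X * RmatU q n) := by
    ext x y
    exact RingQuot.mkAlgHom_rel ℂ (h x y)
  simpa only [map_mul, hR, h1, h2] using this

lemma rll_Lp_Lp : (Rmat q n).map (algebraMap ℂ (Uq q n)) * M1 (Lp q n) * M2 (Lp q n) =
    M2 (Lp q n) * M1 (Lp q n) * (Rmat q n).map (algebraMap ℂ (Uq q n)) :=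
  rll_of_rel UqRel.rllPP

lemma rll_Lp_Lm : (Rmat q n).map (algebraMap ℂ (Uq q n)) * M1 (Lp q n) * M2 (Lm q n) =
    M2 (Lm q n) * M1 (Lp q n) * (Rmat q n).map (algebraMap ℂ (Uq q n)) :=
  rll_of_rel UqRel.rllPM

lemma rll_Lm_Lm : (Rmat q n).map (algebraMap ℂ (Uq q n)) * M1 (Lm q n) * M2 (Lm q n) =
    M2 (Lm q n) * M1 (Lm q n) * (Rmat q n).map (algebraMap ℂ (Uq q n)) :=
  rll_of_rel UqRel.rllMM

lemma rll_swap {X Y : Matrix (Fin n) (Fin n) (Uq q n)}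
    (h : (Rmat q n).map (algebraMap ℂ (Uq q n)) * M1 X * M2 Y =
      M2 Y * M1 X * (Rmat q n).map (algebraMap ℂ (Uq q n))) :
    (rGen q (· > ·)).map (algebraMap ℂ (Uq q n)) * M2 X * M1 Y =
      M1 Y * M2 X * (rGen q (· > ·)).map (algebraMap ℂ (Uq q n)) := by
  have hR : rGen q (· > ·) = (Rmat q n).submatrix Prod.swap Prod.swap := by
    ext x y
    simp only [Rmat_eq_rGen, Matrix.submatrix_apply, rGen, Prod.fst_swap, Prod.snd_swap,
      eq_comm (a := x.2) (b := x.1), and_comm (a := x.2 = _), gt_iff_lt]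
    congr!
  have := congrArg (fun M => M.submatrix (Equiv.prodComm (Fin n) (Fin n))
    (Equiv.prodComm (Fin n) (Fin n))) h
  simp only [← Matrix.submatrix_mul_equiv _ _ _ (Equiv.prodComm (Fin n) (Fin n))] at this
  rw [hR]
  exact this

lemma exchange_Lm (hq : q ≠ 0) {X : Matrix (Fin n) (Fin n) (Uq q n)}
    (h : (Rmat q n).map (algebraMap ℂ (Uq q n)) * M1 X * M2 (Lm q n) =
      M2 (Lm q n) * M1 X * (Rmat q n).map (algebraMap ℂ (Uq q n))) :
    (rGen q⁻¹ (· > ·)).map (algebraMap ℂ (Uq q n)) * M1 (Lm q n) * M2 X =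
      M2 X * M1 (Lm q n) * (rGen q⁻¹ (· > ·)).map (algebraMap ℂ (Uq q n)) := by
  have hinv : (rGen q (· > ·) : Matrix (Fin n × Fin n) _ ℂ) * rGen q⁻¹ (· > ·) = 1 :=
    rGen_mul_inv hq _ fun _ _ => lt_asymm
  have h1 := congrArg (algebraMap ℂ (Uq q n)).mapMatrix hinv
  have h2 := congrArg (algebraMap ℂ (Uq q n)).mapMatrix (mul_eq_one_comm.1 hinv)
  rw [map_mul, map_one] at h1 h2
  simp only [RingHom.mapMatrix_apply] at h1 h2
  have h3 := rll_swap h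
  set r := (rGen q (· > ·) : Matrix (Fin n × Fin n) _ ℂ).map (algebraMap ℂ (Uq q n))
  set s := (rGen q⁻¹ (· > ·) : Matrix (Fin n × Fin n) _ ℂ).map (algebraMap ℂ (Uq q n))
  calc s * M1 (Lm q n) * M2 X = s * (M1 (Lm q n) * M2 X * r) * s := by
        rw [mul_assoc s, mul_assoc s, mul_assoc _ r, h1, mul_one]
    _ = M2 X * M1 (Lm q n) * s := by
        rw [← h3, mul_assoc r, ← mul_assoc s, h2, one_mul]

lemma SUpoly_commute_Lp (hq : q ≠ 0) {m : ℕ} {K : Matrix (Fin n) (Fin n) (Uq q n)}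
    (hK : Lm q n * K = 1) (hK' : K * Lm q n = 1) {μ : YoungDiagram} (U : StdTab μ m)
    {φ : Hecke q m →ₐ[ℂ] TMat ℂ n m} (hφ : IsHeckeRep q n m φ) (e : Hecke q m) (z : ℂ)
    (i j : Fin n) :
    SUpoly q n m U (φ e) (Lmat q n K) z * Lp q n i j =
      Lp q n i j * SUpoly q n m U (φ e) (Lmat q n K) z := by
  refine SUpoly_commute_of_exchange (S := rGen q (· < ·))
    (rGen_mul_inv hq _ fun _ _ => lt_asymm)
    (Rcheck_commute_blockPair _ _ (rAct_yangBaxter hq)) (rGen_lt_trace hq) ?_ U hφ e z i j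
  rw [Lmat, M2_mul, ← Rmat_eq_rGen]
  exact commute_mul_of_exchange rll_Lp_Lp rll_Lp_Lm (by rw [← M2_mul, hK, M2_one])
    (by rw [← M2_mul, hK', M2_one])

lemma SUpoly_commute_Lm (hq : q ≠ 0) {m : ℕ} {K : Matrix (Fin n) (Fin n) (Uq q n)}
    (hK : Lm q n * K = 1) (hK' : K * Lm q n = 1) {μ : YoungDiagram} (U : StdTab μ m)
    {φ : Hecke q m →ₐ[ℂ] TMat ℂ n m} (hφ : IsHeckeRep q n m φ) (e : Hecke q m) (z : ℂ)
    (i j : Fin n) :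
    SUpoly q n m U (φ e) (Lmat q n K) z * Lm q n i j =
      Lm q n i j * SUpoly q n m U (φ e) (Lmat q n K) z := by
  refine SUpoly_commute_of_exchange (S := rGen q⁻¹ (· > ·))
    (rGen_mul_inv (inv_ne_zero hq) _ fun _ _ => lt_asymm)
    (Rcheck_commute_blockPair _ _ (rAct_yangBaxter_gt hq)) (rGen_gt_trace hq) ?_ U hφ e z i j
  rw [Lmat, M2_mul]
  exact commute_mul_of_exchange (exchange_Lm hq rll_Lp_Lm) (exchange_Lm hq rll_Lm_Lm)
    (by rw [← M2_mul, hK, M2_one]) (by rw [← M2_mul, hK', M2_one])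

end Exchange

/-- for every `z ∈ ℂ`, the value `S_U(z)` of the q-immanant polynomial lies
in the center of `U_q(gl_n)`; hence all its coefficients do. -/
theorem qimmanant_poly_central (n : ℕ) (hn : 1 ≤ n) (q : ℂ) (hq : q ≠ 0)
    (hq' : NotRootOfUnity q) (m : ℕ) (μ : YoungDiagram) (hcard : μ.cells.card = m)
    (hrow : ∀ c ∈ μ.cells, c.1 < n) (U : StdTab μ m)
    (φ : Hecke q m →ₐ[ℂ] Matrix (Fin m → Fin n) (Fin m → Fin n) ℂ)
    (hφ : IsHeckeRep q n m φ) (e : Hecke q m) (he : IsJMIdem q m U e)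
    (K : Matrix (Fin n) (Fin n) (Uq q n)) (hK1 : Lm q n * K = 1) (hK2 : K * Lm q n = 1)
    (z : ℂ) (w : Uq q n) :
    SUpoly q n m U (φ e) (Lmat q n K) z * w = w * SUpoly q n m U (φ e) (Lmat q n K) z := by
  obtain ⟨x, rfl⟩ := RingQuot.mkAlgHom_surjective ℂ (UqRel q n) w
  induction x using FreeAlgebra.induction with
  | grade0 r => rw [AlgHom.commutes, Algebra.commutes]
  | grade1 g =>
    rcases g with ⟨i, j⟩ | ⟨i, j⟩
    · exact SUpoly_commute_Lp hq hK1 hK2 U hφ e z i j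
    · exact SUpoly_commute_Lm hq hK1 hK2 U hφ e z i j
  | mul x y hx hy => rw [map_mul, ← mul_assoc, hx, mul_assoc, hy, mul_assoc]
  | add x y hx hy => rw [map_add, mul_add, add_mul, hx, hy]

end QImm
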